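/- arXiv:2211.06938 — 2 statements merged into one kernel-verified Lean document; each statement's English description precedes it below -/
import Mathlib

section
/- Every Heisenberg Lie superalgebra with odd one-dimensional center has trivial Bogomolov multiplier: B̃₀(H_m) = 0 for all m ≥ 1. -/
/-!
Basic definitions for Lie superalgebras over a commutative ring `K`,
graded ideals, the nonabelian (CP) exterior products and the Bogomolov multiplier.
-/

universe u v

namespace BogomolovSuper

/-- The sign `(-1)^{|i||j|}` attached to a pair of `ℤ₂`-degrees. -/
def sgn (i j : ZMod 2) : ℤ := (-1) ^ (i.val * j.val)

/-- A Lie superalgebra structure on a `K`-module `L`: a `ℤ₂`-grading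
`gr` with `L = gr 0 ⊕ gr 1` together with a super bracket satisfying
super skew-symmetry, the super Jacobi identity and `[x,x] = 0` for even `x`. -/
structure SuperAlg (K : Type u) [CommRing K] (L : Type v)
    [AddCommGroup L] [Module K L] where
  bk : L →ₗ[K] L →ₗ[K] L
  gr : ZMod 2 → Submodule K L
  gr_inf : gr 0 ⊓ gr 1 = ⊥
  gr_sup : gr 0 ⊔ gr 1 = ⊤
  bk_gr : ∀ i j : ZMod 2, ∀ x ∈ gr i, ∀ y ∈ gr j, bk x y ∈ gr (i + j)
  skew : ∀ i j : ZMod 2, ∀ x ∈ gr i, ∀ y ∈ gr j, bk x y = -(sgn i j • bk y x)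
  jacobi : ∀ i j : ZMod 2, ∀ x ∈ gr i, ∀ y ∈ gr j, ∀ z : L,
    bk x (bk y z) = bk (bk x y) z + sgn i j • bk y (bk x z)
  even_sq : ∀ x ∈ gr 0, bk x x = 0

variable {K : Type u} [CommRing K]

section Defs

variable {L L' E : Type v} [AddCommGroup L] [Module K L]
  [AddCommGroup L'] [Module K L'] [AddCommGroup E] [Module K E]

/-- A homomorphism of Lie superalgebras of even degree (degree zero). -/
def IsSuperHom (s : SuperAlg K L) (s' : SuperAlg K L') (f : L →ₗ[K] L') : Prop :=
  (∀ x y : L, f (s.bk x y) = s'.bk (f x) (f y)) ∧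
  (∀ i : ZMod 2, ∀ x ∈ s.gr i, f x ∈ s'.gr i)

/-- A graded (homogeneous) ideal of a Lie superalgebra. -/
def IsGradedIdeal (s : SuperAlg K L) (M : Submodule K L) : Prop :=
  (∀ x : L, ∀ m ∈ M, s.bk x m ∈ M ∧ s.bk m x ∈ M) ∧
  (∀ m ∈ M, ∃ m₀ ∈ M ⊓ s.gr 0, ∃ m₁ ∈ M ⊓ s.gr 1, m = m₀ + m₁)

/-- The sub-Lie-superalgebra generated by a set: the smallest submodule
containing the set and closed under the bracket. -/
def lieSpan (s : SuperAlg K E) (S : Set E) : Submodule K E :=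
  sInf {p : Submodule K E | S ⊆ p ∧ ∀ x ∈ p, ∀ y ∈ p, s.bk x y ∈ p}

/-- `K(L)`: the set of all brackets `[a,b]`. -/
def bkSet (s : SuperAlg K L) : Set L := {x : L | ∃ a b : L, x = s.bk a b}

/-- The derived subalgebra `L² = [L,L]` (as a submodule; it is a graded ideal). -/
def derived (s : SuperAlg K L) : Submodule K L := Submodule.span K (bkSet s)

/-- The descending central series of a Lie superalgebra. -/
def lcs (s : SuperAlg K L) : ℕ → Submodule K L
  | 0 => ⊤
  | n + 1 => Submodule.span K {x : L | ∃ a ∈ lcs s n, ∃ b : L, x = s.bk a b}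

/-- Nilpotency of a Lie superalgebra. -/
def IsNilpotentSuper (s : SuperAlg K L) : Prop := ∃ c : ℕ, lcs s c = ⊥

/-- A Lie super exterior pairing on a pair of graded ideals `M`, `N` of `(L, s)`,
with values in a Lie superalgebra `(E, t)`. -/
structure IsExtPairing (s : SuperAlg K L) (M N : Submodule K L)
    (t : SuperAlg K E) (ρ : L → L → E) : Prop where
  grade : ∀ i j : ZMod 2, ∀ m ∈ M ⊓ s.gr i, ∀ n ∈ N ⊓ s.gr j, ρ m n ∈ t.gr (i + j)
  smul_left : ∀ (c : K) (i j : ZMod 2), ∀ m ∈ M ⊓ s.gr i, ∀ n ∈ N ⊓ s.gr j,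
    ρ (c • m) n = c • ρ m n
  smul_right : ∀ (c : K) (i j : ZMod 2), ∀ m ∈ M ⊓ s.gr i, ∀ n ∈ N ⊓ s.gr j,
    ρ m (c • n) = c • ρ m n
  add_left : ∀ (i j : ZMod 2), ∀ m ∈ M ⊓ s.gr i, ∀ m' ∈ M ⊓ s.gr i, ∀ n ∈ N ⊓ s.gr j,
    ρ (m + m') n = ρ m n + ρ m' n
  add_right : ∀ (i j : ZMod 2), ∀ m ∈ M ⊓ s.gr i, ∀ n ∈ N ⊓ s.gr j, ∀ n' ∈ N ⊓ s.gr j,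
    ρ m (n + n') = ρ m n + ρ m n'
  bk_left : ∀ (i i' j : ZMod 2), ∀ m ∈ M ⊓ s.gr i, ∀ m' ∈ M ⊓ s.gr i', ∀ n ∈ N ⊓ s.gr j,
    ρ (s.bk m m') n = ρ m (s.bk m' n) - sgn i i' • ρ m' (s.bk m n)
  bk_right : ∀ (i j j' : ZMod 2), ∀ m ∈ M ⊓ s.gr i, ∀ n ∈ N ⊓ s.gr j, ∀ n' ∈ N ⊓ s.gr j',
    ρ m (s.bk n n') = sgn j' (i + j) • ρ (s.bk n' m) n - sgn i j • ρ (s.bk n m) n'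
  bk_pair : ∀ (i j i' j' : ZMod 2), ∀ m ∈ M ⊓ s.gr i, ∀ n ∈ N ⊓ s.gr j,
    ∀ m' ∈ M ⊓ s.gr i', ∀ n' ∈ N ⊓ s.gr j',
    t.bk (ρ m n) (ρ m' n') = -(sgn i j • ρ (s.bk n m) (s.bk m' n'))

/-- A Lie super `B̃₀`-pairing: an exterior pairing that moreover kills the
commutativity-preserving relations. -/
structure IsB0Pairing (s : SuperAlg K L) (M N : Submodule K L)
    (t : SuperAlg K E) (ρ : L → L → E)
    extends IsExtPairing s M N t ρ : Prop where
  rel_pair : ∀ (i j i' j' : ZMod 2), ∀ m ∈ M ⊓ s.gr i, ∀ n ∈ N ⊓ s.gr j,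
    ∀ m' ∈ M ⊓ s.gr i', ∀ n' ∈ N ⊓ s.gr j',
    s.bk m n + sgn i' j' • s.bk m' n' = 0 → ρ m n + sgn i' j' • ρ m' n' = 0
  rel_even : ∀ m ∈ M ⊓ s.gr 0, ∀ n ∈ N ⊓ s.gr 0, s.bk m n = 0 → ρ m n = 0

/-- The set of wedge generators `m ∧ n` (`m`, `n` homogeneous). -/
def wedgeSet (s : SuperAlg K L) (M N : Submodule K L) (ρ : L → L → E) : Set E :=
  {e : E | ∃ i j : ZMod 2, ∃ m ∈ M ⊓ s.gr i, ∃ n ∈ N ⊓ s.gr j, e = ρ m n}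

/-- `(E, t, ρ)` is the nonabelian exterior product `M ∧ N`: `ρ` is a universal
exterior pairing whose image generates `E`. -/
structure IsExtProduct (s : SuperAlg K L) (M N : Submodule K L)
    (t : SuperAlg K E) (ρ : L → L → E) : Prop where
  pairing : IsExtPairing s M N t ρ
  gen : Submodule.span K (wedgeSet s M N ρ) = ⊤
  lift : ∀ {E' : Type v} [AddCommGroup E'] [Module K E'],
    ∀ (t' : SuperAlg K E') (ρ' : L → L → E'), IsExtPairing s M N t' ρ' →
    ∃ f : E →ₗ[K] E', IsSuperHom t t' f ∧
      ∀ (i j : ZMod 2), ∀ m ∈ M ⊓ s.gr i, ∀ n ∈ N ⊓ s.gr j, f (ρ m n) = ρ' m n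

/-- `(E, t, ρ)` is the commutativity preserving (CP) exterior product `M ⋏ N`:
`ρ` is a universal `B̃₀`-pairing whose image generates `E`. -/
structure IsCPProduct (s : SuperAlg K L) (M N : Submodule K L)
    (t : SuperAlg K E) (ρ : L → L → E) : Prop where
  pairing : IsB0Pairing s M N t ρ
  gen : Submodule.span K (wedgeSet s M N ρ) = ⊤
  lift : ∀ {E' : Type v} [AddCommGroup E'] [Module K E'],
    ∀ (t' : SuperAlg K E') (ρ' : L → L → E'), IsB0Pairing s M N t' ρ' →
    ∃ f : E →ₗ[K] E', IsSuperHom t t' f ∧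
      ∀ (i j : ZMod 2), ∀ m ∈ M ⊓ s.gr i, ∀ n ∈ N ⊓ s.gr j, f (ρ m n) = ρ' m n

/-- Generators of `M₀(M,N)` inside the exterior product. -/
def M0Set (s : SuperAlg K L) (M N : Submodule K L) (ρ : L → L → E) : Set E :=
  {e : E | ∃ i j i' j' : ZMod 2, ∃ m ∈ M ⊓ s.gr i, ∃ n ∈ N ⊓ s.gr j,
      ∃ m' ∈ M ⊓ s.gr i', ∃ n' ∈ N ⊓ s.gr j',
      s.bk m n + sgn i' j' • s.bk m' n' = 0 ∧ e = ρ m n + sgn i' j' • ρ m' n'} ∪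
  {e : E | ∃ m ∈ M ⊓ s.gr 0, ∃ n ∈ N ⊓ s.gr 0, s.bk m n = 0 ∧ e = ρ m n}

/-- `M₀(M,N)`, the graded submodule of the exterior product generated
by the commutativity-preserving relations. -/
def M0 (s : SuperAlg K L) (M N : Submodule K L) (ρ : L → L → E) : Submodule K E :=
  Submodule.span K (M0Set s M N ρ)

/-- `κ` is the commutator map `κ̃ : m ∧ n ↦ [m,n]`. -/
def IsCommMap (s : SuperAlg K L) (M N : Submodule K L) (ρ : L → L → E)
    (κ : E →ₗ[K] L) : Prop :=
  ∀ (i j : ZMod 2), ∀ m ∈ M ⊓ s.gr i, ∀ n ∈ N ⊓ s.gr j, κ (ρ m n) = s.bk m n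

/-- The Bogomolov multiplier `B̃₀(L) = M(L)/M₀(L)` of `(L,s)` is trivial:
for any realization of the exterior product `L ∧ L` and of the commutator
map `κ̃`, the kernel `M(L)` of `κ̃` is contained in `M₀(L)`. -/
def HasTrivialBog (s : SuperAlg K L) : Prop :=
  ∀ {E' : Type v} [AddCommGroup E'] [Module K E'],
    ∀ (t : SuperAlg K E') (w : L → L → E'), IsExtProduct s ⊤ ⊤ t w →
    ∀ κ : E' →ₗ[K] L, IsCommMap s ⊤ ⊤ w κ → LinearMap.ker κ ≤ M0 s ⊤ ⊤ w

end Defs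

section Free

variable {F : Type v} [AddCommGroup F] [Module K F]

/-- `(F, sF)` is the free Lie superalgebra on the `ℤ₂`-graded set `X`. -/
structure IsFreeSuper (sF : SuperAlg K F) (X : ZMod 2 → Set F) : Prop where
  subset : ∀ i : ZMod 2, X i ⊆ sF.gr i
  gen : lieSpan sF (X 0 ∪ X 1) = ⊤
  lift : ∀ {M : Type v} [AddCommGroup M] [Module K M],
    ∀ (sM : SuperAlg K M) (f : F → M), (∀ i : ZMod 2, ∀ x ∈ X i, f x ∈ sM.gr i) →
    ∃ g : F →ₗ[K] M, IsSuperHom sF sM g ∧ ∀ x ∈ X 0 ∪ X 1, g x = f x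

end Free

end BogomolovSuper

namespace BogomolovSuper

/-- If a super bracket takes values in the line through `z = [a, b]`, with `a` even, `b` odd and
`z` nonzero, then the Bogomolov multiplier is trivial. -/
theorem hasTrivialBog_of_bk_mem_span_singleton
    {𝕜 : Type u} [Field 𝕜] {L : Type v} [AddCommGroup L] [Module 𝕜 L] (s : SuperAlg 𝕜 L)
    {a b z : L} (ha : a ∈ s.gr 0) (hb : b ∈ s.gr 1) (hab : s.bk a b = z) (hz : z ≠ 0)
    (hbk : ∀ l l', s.bk l l' ∈ Submodule.span 𝕜 {z}) : HasTrivialBog s := by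
  intro E _ _ t w hw κ hκ
  have key : ∀ e : E, ∃ c : 𝕜, e - c • w a b ∈ M0 s ⊤ ⊤ w ∧ κ e = c • z := by
    intro e
    have he : e ∈ Submodule.span 𝕜 (wedgeSet s ⊤ ⊤ w) := hw.gen ▸ Submodule.mem_top
    induction he using Submodule.span_induction with
    | mem e he =>
      obtain ⟨i, j, p, hp, q, hq, rfl⟩ := he
      obtain ⟨c, hc⟩ := Submodule.mem_span_singleton.1 (hbk p q)
      refine ⟨c, Submodule.subset_span (Or.inl ⟨i, j, 0, 1, p, hp, q, hq, (-c) • a,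
        ⟨trivial, Submodule.smul_mem _ _ ha⟩, b, ⟨trivial, hb⟩, ?_, ?_⟩), ?_⟩
      · simp [sgn, hab, ← hc]
      · rw [hw.pairing.smul_left (-c) 0 1 a ⟨trivial, ha⟩ b ⟨trivial, hb⟩]
        simp [sgn, sub_eq_add_neg]
      · rw [hκ i j p hp q hq, hc]
    | zero => exact ⟨0, by simp, by simp⟩
    | add e f _ _ he hf =>
      obtain ⟨c, hc, hc'⟩ := he
      obtain ⟨d, hd, hd'⟩ := hf
      refine ⟨c + d, ?_, by rw [map_add, hc', hd', add_smul]⟩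
      rw [add_smul, add_sub_add_comm]
      exact add_mem hc hd
    | smul k e _ he =>
      obtain ⟨c, hc, hc'⟩ := he
      refine ⟨k * c, ?_, by rw [map_smul, hc', mul_smul]⟩
      rw [mul_smul, ← smul_sub]
      exact Submodule.smul_mem _ _ hc
  intro e he
  obtain ⟨c, hc, hc'⟩ := key e
  rw [LinearMap.mem_ker.1 he, eq_comm, smul_eq_zero, or_iff_left hz] at hc'
  simpa [hc'] using hc

/-- Every Heisenberg Lie superalgebra with odd one-dimensional
center has trivial Bogomolov multiplier: `B̃₀(H_m) = 0` for all `m ≥ 1`.  Here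
`H_m` has even basis `x₁, …, x_m`, odd basis `y₁, …, y_m, z`, and the only
nonzero brackets among basis elements are `[x_j, y_j] = z = -[y_j, x_j]`. -/
theorem heisenberg_odd_center_trivial_bogomolov
    {𝕜 : Type u} [Field 𝕜] {L : Type v} [AddCommGroup L] [Module 𝕜 L]
    (m : ℕ) (hm : 1 ≤ m) (s : SuperAlg 𝕜 L)
    (x y : Fin m → L) (z : L)
    (hbasis : LinearIndependent 𝕜 (Sum.elim x (Sum.elim y (fun _ : Unit => z))))
    (hspan : Submodule.span 𝕜 (Set.range x ∪ Set.range y ∪ {z}) = ⊤)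
    (hgr0 : s.gr 0 = Submodule.span 𝕜 (Set.range x))
    (hgr1 : s.gr 1 = Submodule.span 𝕜 (Set.range y ∪ {z}))
    (hxx : ∀ i j, s.bk (x i) (x j) = 0)
    (hxy : ∀ i j, s.bk (x i) (y j) = if i = j then z else 0)
    (hyx : ∀ i j, s.bk (y i) (x j) = if i = j then -z else 0)
    (hyy : ∀ i j, s.bk (y i) (y j) = 0)
    (hz : ∀ l : L, s.bk z l = 0 ∧ s.bk l z = 0) :
    HasTrivialBog s := by
  have hz0 : z ≠ 0 := hbasis.ne_zero (Sum.inr (Sum.inr ()))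
  intro E _ _
  refine hasTrivialBog_of_bk_mem_span_singleton s (a := x ⟨0, hm⟩) (b := y ⟨0, hm⟩)
    (hgr0 ▸ Submodule.subset_span ⟨_, rfl⟩)
    (hgr1 ▸ Submodule.subset_span (Or.inl ⟨_, rfl⟩)) (by simp [hxy]) hz0 fun l l' => ?_
  have hzz : z ∈ Submodule.span 𝕜 {z} := Submodule.mem_span_singleton_self z
  have hl : l ∈ Submodule.span 𝕜 (Set.range x ∪ Set.range y ∪ {z}) := hspan ▸ Submodule.mem_top
  have hl' : l' ∈ Submodule.span 𝕜 (Set.range x ∪ Set.range y ∪ {z}) := hspan ▸ Submodule.mem_top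
  induction hl, hl' using Submodule.span_induction₂ with
  | mem_mem p q hp hq =>
    rcases hp with (⟨i, rfl⟩ | ⟨i, rfl⟩) | rfl
    · rcases hq with (⟨j, rfl⟩ | ⟨j, rfl⟩) | rfl
      · simp [hxx]
      · rw [hxy]; split_ifs <;> simp [hzz]
      · simp [(hz _).2]
    · rcases hq with (⟨j, rfl⟩ | ⟨j, rfl⟩) | rfl
      · rw [hyx]; split_ifs <;> simp [hzz]
      · simp [hyy]
      · simp [(hz _).2]
    · simp [(hz _).1]
  | zero_left => simp
  | zero_right => simp
  | add_left _ _ _ _ _ _ h h' => simpa using add_mem h h'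
  | add_right _ _ _ _ _ _ h h' => simpa using add_mem h h'
  | smul_left c _ _ _ _ h => simpa using Submodule.smul_mem _ c h
  | smul_right c _ _ _ _ h => simpa using Submodule.smul_mem _ c h

end BogomolovSuper
end

section
/- Let L be a nilpotent Lie superalgebra of superdimension (k|l) over a field with dim L² = (r|s), where r + s = 1. Then B̃₀(L) = 0, in both cases (r,s) = (1,0) and (r,s) = (0,1). -/
/-!
Basic definitions for Lie superalgebras over a commutative ring `K`,
graded ideals, the nonabelian (CP) exterior products and the Bogomolov multiplier.
-/

universe u v

namespace BogomolovSuper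

section Auxiliary

variable {K : Type u} [CommRing K] {L E : Type v}
  [AddCommGroup L] [Module K L] [AddCommGroup E] [Module K E]

theorem sgn_mul_self (i j : ZMod 2) : sgn i j * sgn i j = 1 := by
  rw [sgn, ← mul_pow]
  norm_num

/-- Two wedges whose brackets are proportional are proportional modulo `M₀(L)`. -/
theorem wedge_sub_smul_wedge_mem_M0 {s : SuperAlg K L} {t : SuperAlg K E} {w : L → L → E}
    (hw : IsExtPairing s ⊤ ⊤ t w) {i j i' j' : ZMod 2} {m n a b : L}
    (hm : m ∈ s.gr i) (hn : n ∈ s.gr j) (ha : a ∈ s.gr i') (hb : b ∈ s.gr j')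
    {c : K} (h : s.bk m n = c • s.bk a b) : w m n - c • w a b ∈ M0 s ⊤ ⊤ w := by
  have hsgn : ((sgn i' j' : ℤ) : K) * (sgn i' j' : ℤ) = 1 := by
    exact_mod_cast congrArg (Int.cast (R := K)) (sgn_mul_self i' j')
  have hcoef : ((sgn i' j' : ℤ) : K) * (-((sgn i' j' : ℤ) : K) * c) = -c := by
    linear_combination -c * hsgn
  refine Submodule.subset_span (Or.inl ⟨i, j, i', j', m, ⟨trivial, hm⟩, n, ⟨trivial, hn⟩,
    (-((sgn i' j' : ℤ) : K) * c) • a, ⟨trivial, Submodule.smul_mem _ _ ha⟩,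
    b, ⟨trivial, hb⟩, ?_, ?_⟩)
  · rw [map_smul, LinearMap.smul_apply, ← Int.cast_smul_eq_zsmul K, smul_smul, hcoef, h,
      neg_smul, add_neg_cancel]
  · rw [hw.smul_left _ i' j' a ⟨trivial, ha⟩ b ⟨trivial, hb⟩, ← Int.cast_smul_eq_zsmul K,
      smul_smul, hcoef, neg_smul, sub_eq_add_neg]

theorem M0_le_ker {s : SuperAlg K L} {M N : Submodule K L} {w : L → L → E} {κ : E →ₗ[K] L}
    (hκ : IsCommMap s M N w κ) : M0 s M N w ≤ LinearMap.ker κ := by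
  refine Submodule.span_le.2 ?_
  rintro _ (⟨i, j, i', j', m, hm, n, hn, m', hm', n', hn', h, rfl⟩ | ⟨m, hm, n, hn, h, rfl⟩)
  · simpa [hκ i j m hm n hn, hκ i' j' m' hm' n' hn'] using h
  · simpa [hκ 0 0 m hm n hn] using h

/-- The Bogomolov multiplier vanishes as soon as all homogeneous brackets are multiples of
a single one of them. -/
theorem hasTrivialBog_of_forall_bk_eq_smul {s : SuperAlg K L} {i' j' : ZMod 2} {a b : L}
    (ha : a ∈ s.gr i') (hb : b ∈ s.gr j')
    (h : ∀ i j : ZMod 2, ∀ m ∈ s.gr i, ∀ n ∈ s.gr j, ∃ c : K, s.bk m n = c • s.bk a b) :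
    HasTrivialBog s := by
  intro E' _ _ t w hw κ hκ e he
  have hspan : e ∈ Submodule.span K {w a b} ⊔ M0 s ⊤ ⊤ w := by
    have htop : Submodule.span K (wedgeSet s ⊤ ⊤ w) ≤
        Submodule.span K {w a b} ⊔ M0 s ⊤ ⊤ w := by
      refine Submodule.span_le.2 ?_
      rintro _ ⟨i, j, m, ⟨-, hm⟩, n, ⟨-, hn⟩, rfl⟩
      obtain ⟨c, hc⟩ := h i j m hm n hn
      exact Submodule.mem_sup.2 ⟨c • w a b, Submodule.mem_span_singleton.2 ⟨c, rfl⟩, _,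
        wedge_sub_smul_wedge_mem_M0 hw.pairing hm hn ha hb hc, add_sub_cancel _ _⟩
    exact htop (hw.gen ▸ Submodule.mem_top)
  obtain ⟨y, hy, e₀, he₀, rfl⟩ := Submodule.mem_sup.1 hspan
  obtain ⟨d, rfl⟩ := Submodule.mem_span_singleton.1 hy
  have hd : d • s.bk a b = 0 := by
    have hκe₀ : κ e₀ = 0 := M0_le_ker hκ he₀
    simpa [hκe₀, hκ i' j' a ⟨trivial, ha⟩ b ⟨trivial, hb⟩] using he
  have hbk : s.bk (d • a) b = (0 : K) • s.bk a b := by simpa using hd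
  have hmem := wedge_sub_smul_wedge_mem_M0 hw.pairing (Submodule.smul_mem _ d ha) hb ha hb hbk
  rw [zero_smul, sub_zero,
    hw.pairing.smul_left d i' j' a ⟨trivial, ha⟩ b ⟨trivial, hb⟩] at hmem
  exact Submodule.add_mem _ hmem he₀

theorem hasTrivialBog_of_forall_bk_mem_span_singleton {𝕜 : Type u} [Field 𝕜] [Module 𝕜 L]
    {s : SuperAlg 𝕜 L} {z : L}
    (h : ∀ i j : ZMod 2, ∀ m ∈ s.gr i, ∀ n ∈ s.gr j, s.bk m n ∈ Submodule.span 𝕜 {z}) :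
    HasTrivialBog s := by
  by_cases hex : ∃ i j : ZMod 2, ∃ a ∈ s.gr i, ∃ b ∈ s.gr j, s.bk a b ≠ 0
  · obtain ⟨i', j', a, ha, b, hb, hab⟩ := hex
    refine hasTrivialBog_of_forall_bk_eq_smul ha hb fun i j m hm n hn => ?_
    obtain ⟨c, hc⟩ := Submodule.mem_span_singleton.1 (h i j m hm n hn)
    obtain ⟨d, hd⟩ := Submodule.mem_span_singleton.1 (h i' j' a ha b hb)
    have hd₀ : d ≠ 0 := by
      rintro rfl
      exact hab (by rw [← hd, zero_smul])
    exact ⟨c * d⁻¹, by rw [← hc, ← hd, smul_smul, inv_mul_cancel_right₀ hd₀]⟩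
  · push Not at hex
    exact hasTrivialBog_of_forall_bk_eq_smul (Submodule.zero_mem (s.gr 0))
      (Submodule.zero_mem (s.gr 0))
      fun i j m hm n hn => ⟨0, by rw [hex i j m hm n hn, zero_smul]⟩

theorem exists_le_span_singleton_of_finrank_add_eq_one {𝕜 : Type u} [Field 𝕜] [Module 𝕜 L]
    [FiniteDimensional 𝕜 L] {p q : Submodule 𝕜 L}
    (h : Module.finrank 𝕜 p + Module.finrank 𝕜 q = 1) :
    ∃ z : L, p ≤ Submodule.span 𝕜 {z} ∧ q ≤ Submodule.span 𝕜 {z} := by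
  have hle : Module.finrank 𝕜 ↥(p ⊔ q) ≤ 1 :=
    h ▸ Submodule.finrank_add_le_finrank_add_finrank p q
  obtain ⟨z, hz⟩ := finrank_le_one_iff.1 hle
  have hsup : p ⊔ q ≤ Submodule.span 𝕜 {(z : L)} := fun x hx => by
    obtain ⟨c, hc⟩ := hz ⟨x, hx⟩
    exact Submodule.mem_span_singleton.2 ⟨c, congrArg Subtype.val hc⟩
  exact ⟨z, le_sup_left.trans hsup, le_sup_right.trans hsup⟩

end Auxiliary

/-- Let `L` be a nilpotent Lie superalgebra of superdimension
`(k|l)` over a field with `dim L² = (r|s)` and `r + s = 1` (i.e. the derived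
subalgebra is one-dimensional, either even or odd).  Then `B̃₀(L) = 0`. -/
theorem nilpotent_one_dim_derived_trivial_bogomolov
    {𝕜 : Type u} [Field 𝕜] {L : Type v} [AddCommGroup L] [Module 𝕜 L]
    [FiniteDimensional 𝕜 L]
    (s : SuperAlg 𝕜 L) (hnil : IsNilpotentSuper s)
    (k l : ℕ)
    (hk : Module.finrank 𝕜 ↥(s.gr 0) = k) (hl : Module.finrank 𝕜 ↥(s.gr 1) = l)
    (r sdim : ℕ)
    (hr : Module.finrank 𝕜 ↥(derived s ⊓ s.gr 0) = r)
    (hs : Module.finrank 𝕜 ↥(derived s ⊓ s.gr 1) = sdim)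
    (hrs : r + sdim = 1) :
    HasTrivialBog s := by
  subst hr hs
  obtain ⟨z, hz₀, hz₁⟩ := exists_le_span_singleton_of_finrank_add_eq_one hrs
  refine hasTrivialBog_of_forall_bk_mem_span_singleton (z := z) fun i j m hm n hn => ?_
  have hder : s.bk m n ∈ derived s := Submodule.subset_span ⟨m, n, rfl⟩
  have hgr := s.bk_gr i j m hm n hn
  generalize i + j = d at hgr
  fin_cases d
  · exact hz₀ ⟨hder, hgr⟩
  · exact hz₁ ⟨hder, hgr⟩

end BogomolovSuper
end
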